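/- The group of all ℤ-linear automorphisms θ of the lattice Λ satisfying c(θ(t)) = c(t) for all t ∈ Λ is isomorphic to S₂ × (S₃ ≀ S₂), i.e. to the direct product of S₂ with the semidirect product (S₃ × S₃) ⋊ S₂ where the S₂ factor acts by swapping the two S₃ factors. -/

import Mathlib

/-- A BZ triangle datum: coordinates `(y₁,y₂,y₃,z₁,z₂,z₃,z₄,z₅,z₆)` indexed `0,…,8`.
`IsBZ T` says all coordinates are nonnegative and `z₁−z₄ = z₅−z₂ = z₃−z₆`. -/
def IsBZ (T : Fin 9 → ℤ) : Prop :=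
  (∀ i, 0 ≤ T i) ∧ T 3 - T 6 = T 7 - T 4 ∧ T 7 - T 4 = T 5 - T 8

/-- projection to `(ℓ₁,ℓ₂,m₁,m₂,n₁,n₂)`. -/
def pr (T : Fin 9 → ℤ) : Fin 6 → ℤ :=
  ![T 1 + T 6, T 2 + T 7, T 2 + T 8, T 0 + T 3, T 0 + T 4, T 1 + T 5]

/-- the SU(3) triple multiplicity: number of BZ triangles lying over `t`. -/
noncomputable def c (t : Fin 6 → ℤ) : ℕ :=
  Nat.card {T : Fin 9 → ℤ // IsBZ T ∧ pr T = t}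

/-- The lattice Λ of points `(ℓ₁,ℓ₂,m₁,m₂,n₁,n₂) ∈ ℤ⁶` with
`ℓ₁+m₁+n₁ ≡ ℓ₂+m₂+n₂ (mod 3)`, as a ℤ-submodule of `ℤ⁶`. -/
def latticeTM : Submodule ℤ (Fin 6 → ℤ) where
  carrier := {t | (3 : ℤ) ∣ (t 0 + t 2 + t 4 - t 1 - t 3 - t 5)}
  add_mem' := by
    rintro a b ⟨k, hk⟩ ⟨l, hl⟩
    exact ⟨k + l, by simp only [Pi.add_apply]; linarith⟩
  zero_mem' := ⟨0, by simp⟩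
  smul_mem' := by
    rintro m a ⟨k, hk⟩
    refine ⟨m * k, ?_⟩
    simp only [Pi.smul_apply, smul_eq_mul]
    linear_combination m * hk

/-- The group of all ℤ-linear automorphisms of Λ preserving the triple
multiplicity function. -/
def Gsym : Subgroup (latticeTM ≃ₗ[ℤ] latticeTM) where
  carrier := {θ | ∀ t : latticeTM, c ((θ t : Fin 6 → ℤ)) = c (t : Fin 6 → ℤ)}
  one_mem' := fun _ => rfl
  mul_mem' := by
    intro a b ha hb t
    show c (((a * b) t : Fin 6 → ℤ)) = c (t : Fin 6 → ℤ)
    rw [show (a * b) t = a (b t) from rfl, ha (b t), hb t]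
  inv_mem' := by
    intro a ha t
    have h := ha (a⁻¹ t)
    rw [show a (a⁻¹ t) = t from a.apply_symm_apply t] at h
    exact h.symm

/-- The action of `S₂` on `S₃ × S₃` swapping the two factors. -/
def swapφ : Equiv.Perm (Fin 2) →* MulAut (Equiv.Perm (Fin 3) × Equiv.Perm (Fin 3)) where
  toFun σ := if σ = 1 then 1 else (MulEquiv.prodComm : _ ≃* _)
  map_one' := if_pos rfl
  map_mul' := by
    intro a b
    have h : ∀ x : Equiv.Perm (Fin 2), x = 1 ∨ x = Equiv.swap 0 1 := by decide
    have hsw : Equiv.swap (0 : Fin 2) 1 ≠ 1 := by decide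
    have hmul : Equiv.swap (0 : Fin 2) 1 * Equiv.swap 0 1 = 1 := by decide
    rcases h a with ha | ha <;> rcases h b with hb | hb <;> subst ha <;> subst hb <;>
      simp [hsw, hmul]
    ext x
    all_goals rfl

/-! ### The model: `Λ` as a quotient of `ℤ⁸` -/

/-- Index set of the eight atoms: two `a`'s, three `y`'s, three `b`'s. -/
abbrev Idx := Fin 2 ⊕ (Fin 3 ⊕ Fin 3)

abbrev ia (i : Fin 2) : Idx := Sum.inl i
abbrev iy (i : Fin 3) : Idx := Sum.inr (Sum.inl i)
abbrev ib (i : Fin 3) : Idx := Sum.inr (Sum.inr i)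

/-- sum of the minima over the three blocks -/
def fmin (v : Idx → ℤ) : ℤ :=
  min (v (ia 0)) (v (ia 1)) + min (min (v (iy 0)) (v (iy 1))) (v (iy 2))
    + min (min (v (ib 0)) (v (ib 1))) (v (ib 2))

def piFun (v : Idx → ℤ) : Fin 6 → ℤ :=
  ![v (iy 1) + v (ia 1) + v (ib 0), v (iy 2) + v (ia 0) + v (ib 1),
    v (iy 2) + v (ia 1) + v (ib 2), v (iy 0) + v (ia 0) + v (ib 0),
    v (iy 0) + v (ia 1) + v (ib 1), v (iy 1) + v (ia 0) + v (ib 2)]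

theorem mem_lattice (t : Fin 6 → ℤ) :
    t ∈ latticeTM ↔ (3 : ℤ) ∣ (t 0 + t 2 + t 4 - t 1 - t 3 - t 5) := Iff.rfl

theorem piFun_mem (v : Idx → ℤ) : piFun v ∈ latticeTM := by
  rw [mem_lattice]
  refine ⟨v (ia 1) - v (ia 0), ?_⟩
  simp [piFun]
  ring

def piL : (Idx → ℤ) →ₗ[ℤ] latticeTM where
  toFun v := ⟨piFun v, piFun_mem v⟩
  map_add' v w := by
    ext i
    fin_cases i <;> simp [piFun] <;> ring
  map_smul' m v := by
    ext i
    fin_cases i <;> simp [piFun] <;> ring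

theorem piL_coe (v : Idx → ℤ) : ((piL v : latticeTM) : Fin 6 → ℤ) = piFun v := rfl

def dd (t : Fin 6 → ℤ) : ℤ := (t 0 + t 2 + t 4 - t 1 - t 3 - t 5) / 3

def secFun (t : Fin 6 → ℤ) : Idx → ℤ :=
  Sum.elim ![0, dd t] (Sum.elim
    ![t 3, t 0 - dd t, t 1 - (t 4 - t 3 - dd t)]
    ![0, t 4 - t 3 - dd t, t 5 - t 0 + dd t])

theorem dd_spec {t : Fin 6 → ℤ} (h : t ∈ latticeTM) :
    3 * dd t = t 0 + t 2 + t 4 - t 1 - t 3 - t 5 := by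
  rw [mem_lattice] at h
  exact Int.mul_ediv_cancel' h

def secL : latticeTM →ₗ[ℤ] (Idx → ℤ) where
  toFun t := secFun t
  map_add' t u := by
    have h1 := dd_spec t.2
    have h2 := dd_spec u.2
    have h3 := dd_spec (t + u).2
    have h : dd ((t : Fin 6 → ℤ) + (u : Fin 6 → ℤ)) = dd t + dd u := by
      simp only [Submodule.coe_add, Pi.add_apply] at h3 ⊢
      linarith
    ext i
    rcases i with i | i | i <;> fin_cases i <;> simp [secFun, h] <;> ring
  map_smul' m t := by
    have h1 := dd_spec t.2
    have h3 := dd_spec (m • t).2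
    have h : dd (m • (t : Fin 6 → ℤ)) = m * dd t := by
      simp only [Submodule.coe_smul, Pi.smul_apply, smul_eq_mul] at h3 ⊢
      have h4 : 3 * dd (m • (t : Fin 6 → ℤ)) = 3 * (m * dd t) := by
        linear_combination h3 - m * h1
      linarith
    ext i
    rcases i with i | i | i <;> fin_cases i <;> simp [secFun, -zsmul_eq_mul, h] <;> ring

theorem pi_sec (t : latticeTM) : piL (secL t) = t := by
  have h1 := dd_spec t.2
  ext i
  fin_cases i <;> simp [piL, secL, secFun, piFun] <;> linarith

/-! ### The multiplicity formula -/

theorem c_pi (v : Idx → ℤ) : c (piL v : Fin 6 → ℤ) = (1 + fmin v).toNat := by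
  have key : {T : Fin 9 → ℤ // IsBZ T ∧ pr T = (piL v : Fin 6 → ℤ)} ≃
      Finset.Icc (-(min (min (v (iy 0)) (v (iy 1))) (v (iy 2))))
        (min (v (ia 0)) (v (ia 1)) + min (min (v (ib 0)) (v (ib 1))) (v (ib 2))) := by
    refine ⟨fun T => ⟨T.1 0 - v (iy 0), ?_⟩, fun k => ⟨![v (iy 0) + k.1, v (iy 1) + k.1,
      v (iy 2) + k.1, v (ia 0) + v (ib 0) - k.1, v (ia 1) + v (ib 1) - k.1,
      v (ia 0) + v (ib 2) - k.1, v (ia 1) + v (ib 0) - k.1, v (ia 0) + v (ib 1) - k.1,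
      v (ia 1) + v (ib 2) - k.1], ?_⟩, ?_, ?_⟩
    · obtain ⟨T, ⟨hT, h1, h2⟩, hp⟩ := T
      simp only [piL_coe, pr, piFun, Fin.forall_fin_succ, funext_iff] at hT hp
      simp at hT hp
      simp only [Finset.mem_Icc]
      omega
    · obtain ⟨k, hk⟩ := k
      simp only [Finset.mem_Icc] at hk
      refine ⟨⟨?_, ?_, ?_⟩, ?_⟩
      · intro i
        fin_cases i <;> simp <;> omega
      · simp
      · simp
      · rw [piL_coe]
        ext i
        fin_cases i <;> simp [pr, piFun] <;> ring
    · rintro ⟨T, ⟨hT, h1, h2⟩, hp⟩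
      simp only [piL_coe, pr, piFun, Fin.forall_fin_succ, funext_iff] at hT hp
      simp at hT hp
      apply Subtype.ext
      ext i
      fin_cases i <;> simp <;> omega
    · rintro ⟨k, hk⟩
      simp
  rw [c, Nat.card_congr key, Nat.card_eq_fintype_card, Fintype.card_coe, Int.card_Icc, fmin]
  congr 1
  ring

theorem pi_eq_zero (v : Idx → ℤ) : piL v = 0 ↔ fmin v = 0 ∧ fmin (-v) = 0 := by
  rw [Subtype.ext_iff, piL_coe, funext_iff]
  simp [piFun, fmin, Fin.forall_fin_succ]
  omega

/-! ### Permutations acting -/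

def Good (p : Equiv.Perm Idx) : Prop := ∀ v : Idx → ℤ, fmin (v ∘ p) = fmin v

theorem Good.mul {p q : Equiv.Perm Idx} (hp : Good p) (hq : Good q) : Good (p * q) := by
  intro v
  rw [Equiv.Perm.coe_mul, ← Function.comp_assoc, hq, hp]

theorem Good.inv {p : Equiv.Perm Idx} (hp : Good p) : Good p⁻¹ := by
  intro v
  rw [← hp (v ∘ _)]
  congr 1
  ext i
  simp

/-- permutation of the coordinates of `ℤ⁸` -/
def permL (p : Equiv.Perm Idx) : (Idx → ℤ) →ₗ[ℤ] (Idx → ℤ) := LinearMap.funLeft ℤ ℤ ⇑(p⁻¹)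

theorem permL_apply (p : Equiv.Perm Idx) (v : Idx → ℤ) : permL p v = v ∘ ⇑(p⁻¹) := rfl

theorem permL_ker {p : Equiv.Perm Idx} (hp : Good p) {v : Idx → ℤ} (h : piL v = 0) :
    piL (permL p v) = 0 := by
  rw [pi_eq_zero] at h ⊢
  rw [permL_apply, hp.inv]
  refine ⟨h.1, ?_⟩
  have := hp.inv (-v)
  rw [← h.2, ← this]
  rfl

def endo (p : Equiv.Perm Idx) : Module.End ℤ latticeTM := piL ∘ₗ permL p ∘ₗ secL

theorem endo_pi {p : Equiv.Perm Idx} (hp : Good p) (v : Idx → ℤ) :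
    endo p (piL v) = piL (permL p v) := by
  have h : piL (secL (piL v) - v) = 0 := by rw [map_sub, pi_sec, sub_self]
  have := permL_ker hp h
  rw [map_sub, map_sub, sub_eq_zero] at this
  exact this

/-- basis vectors -/
def ee (i : Idx) : Idx → ℤ := Pi.single i 1

theorem permL_ee (p : Equiv.Perm Idx) (i : Idx) : permL p (ee i) = ee (p i) := by
  ext j
  simp only [permL_apply, ee, Function.comp, Pi.single_apply]
  congr 1
  rw [Equiv.Perm.inv_eq_iff_eq]

/-! ### The group -/

abbrev GG := Equiv.Perm (Fin 2) ×
        ((Equiv.Perm (Fin 3) × Equiv.Perm (Fin 3)) ⋊[swapφ] Equiv.Perm (Fin 2))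

def sw : Equiv.Perm (Fin 2) →* Equiv.Perm (Fin 3 ⊕ Fin 3) where
  toFun σ := if σ = 1 then 1 else Equiv.sumComm _ _
  map_one' := if_pos rfl
  map_mul' := by decide

def rho2 : ((Equiv.Perm (Fin 3) × Equiv.Perm (Fin 3)) ⋊[swapφ] Equiv.Perm (Fin 2)) →*
    Equiv.Perm (Fin 3 ⊕ Fin 3) :=
  SemidirectProduct.lift (Equiv.Perm.sumCongrHom (Fin 3) (Fin 3)) sw (by
    intro g
    have h : ∀ x : Equiv.Perm (Fin 2), x = 1 ∨ x = Equiv.swap 0 1 := by decide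
    have hsw : Equiv.swap (0 : Fin 2) 1 ≠ 1 := by decide
    rcases h g with rfl | rfl
    · ext x
      simp
    · apply MonoidHom.ext
      rintro ⟨α, β⟩
      apply Equiv.ext
      rintro (x | x) <;> simp [sw, swapφ, hsw])

def rho : GG →* Equiv.Perm Idx :=
  (Equiv.Perm.sumCongrHom (Fin 2) (Fin 3 ⊕ Fin 3)).comp
    ((MonoidHom.id _).prodMap rho2)

theorem min3_perm (w : Fin 3 → ℤ) (α : Equiv.Perm (Fin 3)) :
    min (min (w (α 0)) (w (α 1))) (w (α 2)) = min (min (w 0) (w 1)) (w 2) := by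
  apply eq_of_forall_le_iff
  intro k
  have h : (∀ i, k ≤ w (α i)) ↔ ∀ i, k ≤ w i := α.forall_congr_left.trans (by simp)
  simpa [Fin.forall_fin_succ, and_assoc] using h

theorem min2_perm (w : Fin 2 → ℤ) (α : Equiv.Perm (Fin 2)) :
    min (w (α 0)) (w (α 1)) = min (w 0) (w 1) := by
  apply eq_of_forall_le_iff
  intro k
  have h : (∀ i, k ≤ w (α i)) ↔ ∀ i, k ≤ w i := α.forall_congr_left.trans (by simp)
  simpa [Fin.forall_fin_succ, and_assoc] using h

theorem rho_apply (σ τ : Equiv.Perm (Fin 2)) (α β : Equiv.Perm (Fin 3)) :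
    rho (σ, ⟨(α, β), τ⟩) = Equiv.sumCongr σ (Equiv.sumCongr α β * sw τ) := rfl

theorem sw_one : sw 1 = 1 := rfl

theorem sw_swap : sw (Equiv.swap 0 1) = Equiv.sumComm _ _ := by decide

theorem perm2_cases : ∀ x : Equiv.Perm (Fin 2), x = 1 ∨ x = Equiv.swap 0 1 := by decide

theorem rho_good (g : GG) : Good (rho g) := by
  obtain ⟨σ, ⟨⟨α, β⟩, τ⟩⟩ := g
  intro v
  have h1 := min2_perm (fun i => v (ia i)) σ
  have h2 := min3_perm (fun i => v (iy i)) α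
  have h3 := min3_perm (fun i => v (ib i)) β
  simp only [ia, iy, ib] at h1 h2 h3
  rw [rho_apply]
  rcases perm2_cases τ with rfl | rfl
  · simp [sw_one, fmin, h1, h2, h3]
  · simp [sw_swap, fmin, h1, h2, h3]
    ring

theorem rho_inj (g : GG) (h : ∀ i, rho g i = i) : g = 1 := by
  obtain ⟨σ, ⟨⟨α, β⟩, τ⟩⟩ := g
  rw [rho_apply] at h
  have h1 : σ = 1 := by
    ext i
    have := h (ia i)
    simp at this
    simp [this]
  rcases perm2_cases τ with rfl | rfl
  · have h2 : α = 1 := by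
      ext i
      have := h (iy i)
      simp [sw_one] at this
      simp [this]
    have h3 : β = 1 := by
      ext i
      have := h (ib i)
      simp [sw_one] at this
      simp [this]
    subst h1 h2 h3
    rfl
  · have := h (iy 0)
    simp [sw_swap] at this

/-- the representation of `GG` on the lattice -/
def Ehom : GG →* Module.End ℤ latticeTM where
  toFun g := endo (rho g)
  map_one' := by
    ext1 t
    rw [← pi_sec t, endo_pi (rho_good _), map_one]
    rfl
  map_mul' g h := by
    ext1 t
    rw [← pi_sec t, Module.End.mul_apply, endo_pi (rho_good _), endo_pi (rho_good _),
      endo_pi (rho_good _), map_mul]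
    rfl

def Lhom : GG →* (latticeTM ≃ₗ[ℤ] latticeTM) :=
  (LinearMap.GeneralLinearGroup.generalLinearEquiv ℤ latticeTM).toMonoidHom.comp Ehom.toHomUnits

theorem Lhom_pi (g : GG) (v : Idx → ℤ) : Lhom g (piL v) = piL (permL (rho g) v) :=
  endo_pi (rho_good g) v

theorem Lhom_mem (g : GG) : Lhom g ∈ Gsym := by
  intro t
  rw [← pi_sec t, Lhom_pi, c_pi, c_pi, permL_apply, (rho_good g).inv]

def Ghom : GG →* Gsym := Lhom.codRestrict Gsym Lhom_mem

/-! ### Atoms -/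

theorem fmin_shift (v : Idx → ℤ) (h : 0 ≤ fmin v) :
    ∃ w : Idx → ℤ, (∀ i, 0 ≤ w i) ∧ piL w = piL v := by
  refine ⟨Sum.elim (fun i => v (ia i) + min (min (v (iy 0)) (v (iy 1))) (v (iy 2))
      + min (min (v (ib 0)) (v (ib 1))) (v (ib 2)))
    (Sum.elim (fun i => v (iy i) - min (min (v (iy 0)) (v (iy 1))) (v (iy 2)))
      (fun i => v (ib i) - min (min (v (ib 0)) (v (ib 1))) (v (ib 2)))), ?_, ?_⟩
  · unfold fmin at h
    rintro (i | i | i) <;> fin_cases i <;> simp <;> omega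
  · ext i
    fin_cases i <;> simp [piL_coe, piFun] <;> ring

theorem c_pos_iff (v : Idx → ℤ) : 0 < c (piL v : Fin 6 → ℤ) ↔ 0 ≤ fmin v := by
  rw [c_pi]
  omega

theorem exists_nonneg (t : latticeTM) (h : 0 < c (t : Fin 6 → ℤ)) :
    ∃ w : Idx → ℤ, (∀ i, 0 ≤ w i) ∧ piL w = t := by
  rw [← pi_sec t, c_pos_iff] at h
  obtain ⟨w, hw, he⟩ := fmin_shift _ h
  exact ⟨w, hw, he.trans (pi_sec t)⟩

theorem fmin_nonneg {w : Idx → ℤ} (hw : ∀ i, 0 ≤ w i) : 0 ≤ fmin w := by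
  have := hw (ia 0)
  have := hw (ia 1)
  have := hw (iy 0)
  have := hw (iy 1)
  have := hw (iy 2)
  have := hw (ib 0)
  have := hw (ib 1)
  have := hw (ib 2)
  unfold fmin
  omega

theorem pi_ee_inj : ∀ i j : Idx, piL (ee i) = piL (ee j) → i = j := by
  have : ∀ i j : Idx, piFun (ee i) = piFun (ee j) → i = j := by decide
  intro i j h
  exact this i j (congrArg Subtype.val h)

theorem pi_ee_ne (i : Idx) : piL (ee i) ≠ 0 := by
  have : ∀ i : Idx, piFun (ee i) ≠ 0 := by decide
  intro h
  exact this i (congrArg Subtype.val h)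

/-- a nonnegative vector representing an atom is the standard one -/
theorem eq_ee (i : Idx) (w : Idx → ℤ) (hw : ∀ j, 0 ≤ w j) (h : piL w = piL (ee i)) :
    w = ee i := by
  have a0 := hw (ia 0)
  have a1 := hw (ia 1)
  have a2 := hw (iy 0)
  have a3 := hw (iy 1)
  have a4 := hw (iy 2)
  have a5 := hw (ib 0)
  have a6 := hw (ib 1)
  have a7 := hw (ib 2)
  rw [Subtype.ext_iff, piL_coe, piL_coe, funext_iff] at h
  have h0 := h 0
  have h1 := h 1
  have h2 := h 2
  have h3 := h 3
  have h4 := h 4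
  have h5 := h 5
  clear h hw
  simp [piFun] at h0 h1 h2 h3 h4 h5
  simp only [ia, iy, ib] at a0 a1 a2 a3 a4 a5 a6 a7 h0 h1 h2 h3 h4 h5
  ext j
  rcases i with i | i | i <;> fin_cases i <;> simp [ee, Pi.single_apply] at h0 h1 h2 h3 h4 h5 <;>
    rcases j with j | j | j <;> fin_cases j <;> simp [ee, Pi.single_apply] <;> omega

theorem atom (i : Idx) (s t : latticeTM) (hs : 0 < c (s : Fin 6 → ℤ)) (ht : 0 < c (t : Fin 6 → ℤ))
    (h : piL (ee i) = s + t) : s = 0 ∨ t = 0 := by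
  obtain ⟨w, hw, rfl⟩ := exists_nonneg s hs
  obtain ⟨u, hu, rfl⟩ := exists_nonneg t ht
  rw [← map_add] at h
  have h' := eq_ee i (w + u) (fun j => add_nonneg (hw j) (hu j)) h.symm
  have hz : ∀ j, j ≠ i → w j = 0 ∧ u j = 0 := by
    intro j hj
    have := congrFun h' j
    have := hw j
    have := hu j
    simp [ee, hj] at *
    omega
  have hi : w i + u i = 1 := by simpa [ee] using congrFun h' i
  have : w i = 0 ∨ u i = 0 := by
    have := hw i
    have := hu i
    omega
  rcases this with h0 | h0
  · left
    have : w = 0 := by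
      ext j
      by_cases hj : j = i
      · subst hj; exact h0
      · exact (hz j hj).1
    rw [this, map_zero]
  · right
    have : u = 0 := by
      ext j
      by_cases hj : j = i
      · subst hj; exact h0
      · exact (hz j hj).2
    rw [this, map_zero]

theorem image_atom (θ : latticeTM ≃ₗ[ℤ] latticeTM) (hθ : θ ∈ Gsym) (i : Idx) :
    ∃ j, θ (piL (ee i)) = piL (ee j) := by
  have hee : ∀ i j, 0 ≤ ee i j := by
    intro i j
    by_cases h : j = i <;> simp [ee, Pi.single_apply, h]
  have hinv : ∀ t : latticeTM, c (θ.symm t : Fin 6 → ℤ) = c (t : Fin 6 → ℤ) := by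
    intro t
    have := hθ (θ.symm t)
    rw [θ.apply_symm_apply] at this
    exact this.symm
  have hpos : 0 < c (θ (piL (ee i)) : Fin 6 → ℤ) := by
    rw [hθ, c_pos_iff]
    exact fmin_nonneg (hee i)
  obtain ⟨w, hw, hx⟩ := exists_nonneg _ hpos
  have : ∃ j, w j ≠ 0 := by
    by_contra! hc
    have : w = 0 := funext hc
    rw [this, map_zero] at hx
    exact pi_ee_ne i (by simpa using hx.symm)
  obtain ⟨j, hj⟩ := this
  refine ⟨j, ?_⟩
  have hr : ∀ k, 0 ≤ (w - ee j) k := by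
    intro k
    have h1 := hw k
    by_cases h : k = j
    · subst h
      simp [ee]
      omega
    · simpa [ee, h] using h1
  have hsum : piL (ee i) = θ.symm (piL (ee j)) + θ.symm (piL (w - ee j)) := by
    rw [← map_add, ← map_add, add_sub_cancel, hx, θ.symm_apply_apply]
  rcases atom i _ _ (by rw [hinv, c_pos_iff]; exact fmin_nonneg (hee j))
    (by rw [hinv, c_pos_iff]; exact fmin_nonneg hr) hsum with h | h
  · exact absurd (by simpa using h) (pi_ee_ne j)
  · have h' : piL (w - ee j) = 0 := (LinearEquiv.map_eq_zero_iff _).1 h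
    rw [map_sub, sub_eq_zero] at h'
    rw [← hx, h']

/-! ### Which permutations of atoms occur -/

theorem pair_spec : ∀ i j : Idx, i ≠ j → fmin (ee i + ee j) = 1 →
    (∃ k, i = ia k) ∧ (∃ k, j = ia k) := by decide

theorem triple_spec : ∀ i j k : Fin 3 ⊕ Fin 3, i ≠ j → i ≠ k → j ≠ k →
    fmin (ee (Sum.inr i) + ee (Sum.inr j) + ee (Sum.inr k)) = 1 →
    (i.isLeft = true ∧ j.isLeft = true ∧ k.isLeft = true) ∨
    (i.isRight = true ∧ j.isRight = true ∧ k.isRight = true) := by decide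

theorem perm_of_inj {n : ℕ} (f : Fin n → Fin n) (hf : Function.Injective f) :
    ∃ α : Equiv.Perm (Fin n), ∀ i, α i = f i :=
  ⟨Equiv.ofBijective f (Finite.injective_iff_bijective.1 hf), fun _ => rfl⟩

theorem exists_rho (p : Idx → Idx) (hp : Function.Injective p)
    (h2 : fmin (ee (p (ia 0)) + ee (p (ia 1))) = 1)
    (hy : fmin (ee (p (iy 0)) + ee (p (iy 1)) + ee (p (iy 2))) = 1)
    (hb : fmin (ee (p (ib 0)) + ee (p (ib 1)) + ee (p (ib 2))) = 1) :
    ∃ g : GG, ∀ i, rho g i = p i := by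
  -- the `a` block
  have ha : ∀ i, ∃ k, p (ia i) = ia k := by
    have := pair_spec _ _ (hp.ne (by decide)) h2
    intro i
    fin_cases i
    · exact this.1
    · exact this.2
  choose s hs using ha
  have hsi : Function.Injective s := by
    intro i j hij
    have : p (ia i) = p (ia j) := by rw [hs, hs, hij]
    simpa using hp this
  obtain ⟨σ, hσ⟩ := perm_of_inj s hsi
  -- the others
  have hq : ∀ i : Fin 3 ⊕ Fin 3, ∃ k, p (Sum.inr i) = Sum.inr k := by
    intro i
    rcases hpi : p (Sum.inr i) with k | k
    · exfalso
      have h := hs (σ.symm k)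
      rw [← hσ, σ.apply_symm_apply] at h
      have := hp (hpi.trans h.symm)
      simp at this
    · exact ⟨k, rfl⟩
  choose q hq using hq
  have hqi : Function.Injective q := by
    intro i j hij
    have : p (Sum.inr i) = p (Sum.inr j) := by rw [hq, hq, hij]
    simpa using hp this
  simp only [iy, ib, hq] at hy hb
  have ty := triple_spec _ _ _ (hqi.ne (by decide)) (hqi.ne (by decide)) (hqi.ne (by decide)) hy
  have tb := triple_spec _ _ _ (hqi.ne (by decide)) (hqi.ne (by decide)) (hqi.ne (by decide)) hb
  have ty' : (∀ i : Fin 3, ∃ l, q (Sum.inl i) = Sum.inl l) ∨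
      (∀ i : Fin 3, ∃ l, q (Sum.inl i) = Sum.inr l) := by
    simpa [Fin.forall_fin_succ, Sum.isLeft_iff, Sum.isRight_iff] using ty
  have tb' : (∀ i : Fin 3, ∃ l, q (Sum.inr i) = Sum.inl l) ∨
      (∀ i : Fin 3, ∃ l, q (Sum.inr i) = Sum.inr l) := by
    simpa [Fin.forall_fin_succ, Sum.isLeft_iff, Sum.isRight_iff] using tb
  clear ty tb hy hb
  have mk : ∀ (f : Fin 3 → Fin 3) (u v : Fin 3 → Fin 3 ⊕ Fin 3),
      Function.Injective u → (∀ i, q (u i) = v (f i)) → Function.Injective f := by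
    intro f u v hu h i j hij
    apply hu
    apply hqi
    rw [h, h, hij]
  have clash : ∀ (f g : Fin 3 → Fin 3) (v : Fin 3 → Fin 3 ⊕ Fin 3),
      (∀ i, q (Sum.inl i) = v (f i)) → (∀ i, q (Sum.inr i) = v (g i)) → False := by
    intro f g v hf hg
    obtain ⟨α, hα⟩ := perm_of_inj f (mk f Sum.inl v Sum.inl_injective hf)
    have h1 := hf (α.symm (g 0))
    rw [← hα, α.apply_symm_apply, ← hg] at h1
    have := hqi h1
    simp at this
  rcases ty' with ty | ty <;> rcases tb' with tb | tb <;> choose f hf using ty <;>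
    choose g hg using tb
  · exact (clash f g Sum.inl hf hg).elim
  · obtain ⟨α, hα⟩ := perm_of_inj f (mk f _ _ Sum.inl_injective hf)
    obtain ⟨β, hβ⟩ := perm_of_inj g (mk g _ _ Sum.inr_injective hg)
    refine ⟨(σ, ⟨(α, β), 1⟩), ?_⟩
    rintro (i | i | i)
    · rw [rho_apply, hs, ← hσ]
      rfl
    · rw [rho_apply, sw_one, hq, hf, ← hα]
      rfl
    · rw [rho_apply, sw_one, hq, hg, ← hβ]
      rfl
  · obtain ⟨α, hα⟩ := perm_of_inj f (mk f _ _ Sum.inl_injective hf)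
    obtain ⟨β, hβ⟩ := perm_of_inj g (mk g _ _ Sum.inr_injective hg)
    refine ⟨(σ, ⟨(β, α), Equiv.swap 0 1⟩), ?_⟩
    rintro (i | i | i)
    · rw [rho_apply, hs, ← hσ]
      rfl
    · rw [rho_apply, sw_swap, hq, hf, ← hα]
      rfl
    · rw [rho_apply, sw_swap, hq, hg, ← hβ]
      rfl
  · exact (clash f g Sum.inr hf hg).elim

theorem Ghom_inj : Function.Injective Ghom := by
  rw [injective_iff_map_eq_one]
  intro g hg
  apply rho_inj
  intro i
  apply pi_ee_inj
  have h : Lhom g = 1 := congrArg Subtype.val hg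
  rw [← permL_ee, ← Lhom_pi, h]
  rfl

theorem Ghom_surj : Function.Surjective Ghom := by
  rintro ⟨θ, hθ⟩
  choose p hp using image_atom θ hθ
  have hpi : Function.Injective p := by
    intro i j hij
    apply pi_ee_inj
    apply θ.injective
    rw [hp, hp, hij]
  have h2 : fmin (ee (p (ia 0)) + ee (p (ia 1))) = 1 := by
    have := hθ (piL (ee (ia 0) + ee (ia 1)))
    rw [map_add, map_add, hp, hp, ← map_add, ← map_add, c_pi, c_pi,
      show fmin (ee (ia 0) + ee (ia 1)) = 1 by decide] at this
    omega
  have hy : fmin (ee (p (iy 0)) + ee (p (iy 1)) + ee (p (iy 2))) = 1 := by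
    have := hθ (piL (ee (iy 0) + ee (iy 1) + ee (iy 2)))
    rw [map_add, map_add, map_add, map_add, hp, hp, hp, ← map_add, ← map_add, ← map_add,
      ← map_add, c_pi, c_pi,
      show fmin (ee (iy 0) + ee (iy 1) + ee (iy 2)) = 1 by decide] at this
    omega
  have hb : fmin (ee (p (ib 0)) + ee (p (ib 1)) + ee (p (ib 2))) = 1 := by
    have := hθ (piL (ee (ib 0) + ee (ib 1) + ee (ib 2)))
    rw [map_add, map_add, map_add, map_add, hp, hp, hp, ← map_add, ← map_add, ← map_add,
      ← map_add, c_pi, c_pi,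
      show fmin (ee (ib 0) + ee (ib 1) + ee (ib 2)) = 1 by decide] at this
    omega
  obtain ⟨g, hg⟩ := exists_rho p hpi h2 hy hb
  refine ⟨g, Subtype.ext ?_⟩
  have key : (Lhom g).toLinearMap ∘ₗ piL = θ.toLinearMap ∘ₗ piL := by
    apply LinearMap.pi_ext'
    intro i
    ext1
    have h1 : Lhom g (piL (ee i)) = θ (piL (ee i)) := by
      rw [Lhom_pi, permL_ee, hg, hp]
    exact h1
  show Lhom g = θ
  apply LinearEquiv.ext
  intro t
  rw [← pi_sec t]
  exact LinearMap.congr_fun key (secL t)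

theorem stmt11 :
    Nonempty (Gsym ≃*
      Equiv.Perm (Fin 2) ×
        ((Equiv.Perm (Fin 3) × Equiv.Perm (Fin 3)) ⋊[swapφ] Equiv.Perm (Fin 2))) := by
  exact ⟨(MulEquiv.ofBijective Ghom ⟨Ghom_inj, Ghom_surj⟩).symm⟩
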